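/- Let (T,d) be a 1-bounded turning tree, and for x, y ∈ T let [x,y] denote the unique arc joining x and y (with [x,x] = {x}). Then for all x, y ∈ T, sup{|f(y) − f(x)| : f : T → ℝ is 1-Lipschitz and locally flat} = inf{H¹_∞(A) : A ⊆ T and [x,y] ∖ A is H¹-σ-finite}. -/

import Mathlib

open Metric Set MeasureTheory
open scoped ENNReal NNReal

/-- A Lipschitz function `f : M → ℝ` is *locally flat* if for every point `p` and every
`ε > 0` there is `δ > 0` such that `|f x - f y| ≤ ε * d(x,y)` whenever `x, y` are within
distance `δ` of `p`. -/
def LocallyFlat {M : Type*} [MetricSpace M] (f : M → ℝ) : Prop :=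
  ∀ p : M, ∀ ε : ℝ, 0 < ε → ∃ δ : ℝ, 0 < δ ∧ ∀ x y : M,
    dist x p < δ → dist y p < δ → |f x - f y| ≤ ε * dist x y

/-- The Hausdorff 1-content of a set: infimum of `∑ diam (E i)` over countable covers. -/
noncomputable def hausdorffContent {Ω : Type*} [MetricSpace Ω] (S : Set Ω) : ℝ≥0∞ :=
  ⨅ (E : ℕ → Set Ω) (_ : S ⊆ ⋃ i, E i), ∑' i, EMetric.diam (E i)

/-- A set is `H¹`-σ-finite if it is a countable union of sets of finite Hausdorff
1-measure. -/
def IsH1SigmaFinite {M : Type*} [MetricSpace M] [MeasurableSpace M] [BorelSpace M]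
    (S : Set M) : Prop :=
  ∃ T : ℕ → Set M, S = ⋃ n, T n ∧ ∀ n, μH[1] (T n) < ⊤

/-- `γ` is a parametrization of an arc from `x` to `y` (a homeomorphic copy of `[0,1]`,
parametrized on `[0,1]`, starting at `x` and ending at `y`). -/
def IsArcParam {T : Type*} [MetricSpace T] (γ : ℝ → T) (x y : T) : Prop :=
  ContinuousOn γ (Set.Icc 0 1) ∧ Set.InjOn γ (Set.Icc 0 1) ∧ γ 0 = x ∧ γ 1 = y

section helpers

open Filter Topology

lemma sf_of_subset {M : Type*} [MetricSpace M] [MeasurableSpace M] [BorelSpace M]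
    {S : Set M} (A : ℕ → Set M) (h : S ⊆ ⋃ n, A n) (hA : ∀ n, μH[1] (A n) < ⊤) :
    IsH1SigmaFinite S := by
  refine ⟨fun n => S ∩ A n, ?_, fun n => (measure_mono inter_subset_right).trans_lt (hA n)⟩
  rw [← inter_iUnion]
  exact (inter_eq_left.2 h).symm

lemma sf_mono {M : Type*} [MetricSpace M] [MeasurableSpace M] [BorelSpace M]
    {S S' : Set M} (h : S ⊆ S') (hS : IsH1SigmaFinite S') : IsH1SigmaFinite S := by
  obtain ⟨A, rfl, hA⟩ := hS
  exact sf_of_subset A h hA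

lemma sf_finite {M : Type*} [MetricSpace M] [MeasurableSpace M] [BorelSpace M]
    {S : Set M} (h : μH[1] S < ⊤) : IsH1SigmaFinite S :=
  sf_of_subset (fun _ => S) (fun x hx => mem_iUnion.2 ⟨0, hx⟩) (fun _ => h)

lemma sf_iUnion {M : Type*} [MetricSpace M] [MeasurableSpace M] [BorelSpace M]
    {S : ℕ → Set M} (h : ∀ n, IsH1SigmaFinite (S n)) : IsH1SigmaFinite (⋃ n, S n) := by
  choose A hA hA' using h
  refine sf_of_subset (fun k => A k.unpair.1 k.unpair.2) ?_ (fun k => hA' _ _)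
  intro x hx
  obtain ⟨n, hn⟩ := mem_iUnion.1 hx
  rw [hA n] at hn
  obtain ⟨m, hm⟩ := mem_iUnion.1 hn
  exact mem_iUnion.2 ⟨Nat.pair n m, by simpa using hm⟩

lemma sf_union {M : Type*} [MetricSpace M] [MeasurableSpace M] [BorelSpace M]
    {S S' : Set M} (h : IsH1SigmaFinite S) (h' : IsH1SigmaFinite S') :
    IsH1SigmaFinite (S ∪ S') := by
  have : IsH1SigmaFinite (⋃ n : ℕ, if n = 0 then S else S') :=
    sf_iUnion (fun n => by split_ifs <;> assumption)
  refine sf_mono ?_ this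
  rintro x (hx | hx)
  · exact mem_iUnion.2 ⟨0, by simpa using hx⟩
  · exact mem_iUnion.2 ⟨1, by simpa using hx⟩

lemma flat_null {M : Type*} [MetricSpace M] [CompactSpace M] [MeasurableSpace M] [BorelSpace M]
    {f : M → ℝ} (hf : LocallyFlat f) {S : Set M} (hS : μH[1] S < ⊤) :
    volume (f '' S) = 0 := by
  have key : ∀ ε : ℝ≥0, 0 < ε → volume (f '' S) ≤ ε * μH[1] S := by
    intro ε hε
    choose δ hδ hfl using fun p => hf p ε hε
    obtain ⟨t, ht, hcov⟩ := TopologicalSpace.countable_cover_nhds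
      (f := fun p : M => ball p (δ p)) (fun p => ball_mem_nhds p (hδ p))
    rcases isEmpty_or_nonempty M with hM | hM
    · have : S = ∅ := Set.eq_empty_of_isEmpty S
      simp [this]
    have htne : t.Nonempty := by
      rw [Set.nonempty_iff_ne_empty]
      rintro rfl
      simp at hcov
      exact (Set.empty_ne_univ hcov)
    obtain ⟨e, rfl⟩ := ht.exists_eq_range htne
    set B : ℕ → Set M := fun n => ball (e n) (δ (e n)) with hB
    have hBu : ⋃ n, B n = univ := by
      rw [← hcov, biUnion_range]
    set D := disjointed B with hD
    have hDm : ∀ n, MeasurableSet (D n) := MeasurableSet.disjointed (fun n => measurableSet_ball)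
    have hDu : ⋃ n, D n = univ := by rw [hD, iUnion_disjointed, hBu]
    have h1 : f '' S ⊆ ⋃ n, f '' (D n ∩ S) := by
      rw [← image_iUnion, ← iUnion_inter, hDu, univ_inter]
    calc volume (f '' S) ≤ ∑' n, volume (f '' (D n ∩ S)) :=
          (measure_mono h1).trans (measure_iUnion_le _)
      _ ≤ ∑' n, ε * (μH[1].restrict S) (D n) := by
          refine ENNReal.tsum_le_tsum fun n => ?_
          have hl : LipschitzOnWith ε f (D n ∩ S) := by
            refine LipschitzOnWith.of_dist_le_mul ?_
            intro a ha b hb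
            exact hfl (e n) a b (disjointed_subset B n ha.1) (disjointed_subset B n hb.1)
          have := hl.hausdorffMeasure_image_le (d := 1) zero_le_one
          rw [Measure.restrict_apply (hDm n)]
          rw [hausdorffMeasure_real] at this
          simpa using this
      _ = ε * (μH[1].restrict S) (⋃ n, D n) := by
          rw [ENNReal.tsum_mul_left, measure_iUnion (disjoint_disjointed B) hDm]
      _ ≤ ε * μH[1] S := by
          rw [hDu, Measure.restrict_apply_univ]
  by_contra hne
  have hpos : 0 < volume (f '' S) := pos_iff_ne_zero.2 hne
  have : Tendsto (fun ε : ℝ≥0 => (ε : ℝ≥0∞) * μH[1] S) (𝓝[>] 0) (𝓝 (((0 : ℝ≥0) : ℝ≥0∞) * μH[1] S)) := by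
    refine ENNReal.Tendsto.mul_const ?_ (Or.inr hS.ne)
    exact (ENNReal.continuous_coe.tendsto 0).mono_left nhdsWithin_le_nhds
  have h2 := ge_of_tendsto this (eventually_nhdsWithin_of_forall (fun ε hε => key ε hε))
  simp at h2
  exact hne h2

lemma flat_le {M : Type*} [MetricSpace M] [CompactSpace M] [MeasurableSpace M] [BorelSpace M]
    {f : M → ℝ} (hl : LipschitzWith 1 f) (hf : LocallyFlat f) (Z A : Set M)
    (hA : IsH1SigmaFinite (Z \ A)) : volume (f '' Z) ≤ hausdorffContent A := by
  obtain ⟨B, hB, hB'⟩ := hA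
  have h0 : volume (f '' (Z \ A)) = 0 := by
    rw [hB, image_iUnion, measure_iUnion_null_iff]
    exact fun n => flat_null hf (hB' n)
  have h1 : volume (f '' Z) ≤ volume (f '' A) := by
    have : f '' Z ⊆ f '' (Z \ A) ∪ f '' A := by
      rw [← image_union]; exact image_mono (fun z hz => (em (z ∈ A)).elim Or.inr (fun h => Or.inl ⟨hz, h⟩))
    calc _ ≤ _ := measure_mono this
      _ ≤ _ := measure_union_le _ _
      _ = _ := by rw [h0, zero_add]
  refine h1.trans ?_
  unfold hausdorffContent
  refine le_iInf₂ fun E hE => ?_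
  calc volume (f '' A) ≤ volume (⋃ i, f '' E i) := by
        rw [← image_iUnion]; exact measure_mono (image_mono hE)
    _ ≤ ∑' i, volume (f '' E i) := measure_iUnion_le _
    _ ≤ ∑' i, Metric.ediam (E i) := by
        refine ENNReal.tsum_le_tsum fun i => (Real.volume_le_diam _).trans ?_
        simpa using hl.ediam_image_le (E i)

open Classical in
lemma step {M : Type*} [MetricSpace M] [MeasurableSpace M] [BorelSpace M]
    {ι : Type*} [Countable ι] (lev : ι → ℕ) (hfin : ∀ n, {i | lev i < n}.Finite)
    (E : ι → Set M) (r : ℕ → ℝ≥0∞) (hr : Tendsto r atTop (𝓝 0))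
    (hE : ∀ n i, n ≤ lev i → ediam (E i) ≤ r n) (Z : Set M)
    (w : ι → ℝ≥0∞) (c : ℝ≥0∞) (hc0 : c ≠ 0) (hct : c ≠ ⊤) (hc : ∀ i, c ≤ w i)
    (v : ℝ≥0∞) (hv : v ≠ ⊤)
    (h : ∀ S : Set ι, IsH1SigmaFinite (Z \ ⋃ i ∈ S, E i) → v < ∑' i : S, w i * ediam (E i)) :
    ∃ n : ℕ, ∀ S : Set ι, IsH1SigmaFinite (Z \ ⋃ i ∈ S, E i) →
      v < ∑' i : S, (if lev i < n then w i else w i / 2) * ediam (E i) := by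
  by_contra hcon
  push Not at hcon
  choose S hS hSv using hcon
  set S' : Set ι := {i | ∀ᶠ n in (hyperfilter ℕ : Filter ℕ), i ∈ S n} with hS'
  have hlarge : ∀ k : ℕ, ∀ᶠ n in (hyperfilter ℕ : Filter ℕ), k < n := fun k =>
    (eventually_gt_atTop k).filter_mono Nat.hyperfilter_le_atTop
  have hcost : ∑' i : S', w i * ediam (E i) ≤ v := by
    rw [ENNReal.tsum_eq_iSup_sum]
    refine iSup_le fun F => ?_
    have h1 : ∀ᶠ n in (hyperfilter ℕ : Filter ℕ), ∀ i ∈ F, (i : ι) ∈ S n ∧ lev i < n := by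
      rw [Finset.eventually_all]
      exact fun i _ => i.2.and (hlarge _)
    obtain ⟨n, hn⟩ := h1.exists
    refine le_trans ?_ (hSv n)
    have e1 : ∑ i ∈ F, w i * ediam (E i) = ∑ i ∈ F.attach.image (fun i => (⟨i.1.1, (hn i.1 i.2).1⟩ : S n)),
        (if lev i < n then w i else w i / 2) * ediam (E i) := by
      rw [Finset.sum_image, ← Finset.sum_attach]
      · refine Finset.sum_congr rfl fun i _ => ?_
        rw [if_pos (hn i.1 i.2).2]
      · intro a _ b _ hab
        exact Subtype.ext (Subtype.ext (congrArg (fun z : S n => z.1) hab))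
    rw [e1]
    exact ENNReal.sum_le_tsum (f := fun i : S n => (if lev i < n then w i else w i / 2) * ediam (E i)) _
  set N : Set M := ⋃ n, (Z \ ⋃ i ∈ S n, E i) with hN
  have hNs : IsH1SigmaFinite N := sf_iUnion hS
  set R : Set M := (Z \ ⋃ i ∈ S', E i) \ N with hR
  have hRm : μH[1] R ≤ (c / 2)⁻¹ * v := by
    have hex : ∀ k : ℕ, ∃ n, ∀ i, lev i < k → (i ∈ S n ↔ i ∈ S') := by
      intro k
      have : ∀ᶠ n in (hyperfilter ℕ : Filter ℕ), ∀ i ∈ {i | lev i < k}, (i ∈ S n ↔ i ∈ S') := by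
        rw [(hfin k).eventually_all]
        intro i _
        by_cases hi : i ∈ S'
        · filter_upwards [show ∀ᶠ n in (hyperfilter ℕ : Filter ℕ), i ∈ S n from hi] with n hn
          simp [hi, hn]
        · have : ∀ᶠ n in (hyperfilter ℕ : Filter ℕ), ¬ i ∈ S n :=
            Ultrafilter.eventually_not.2 hi
          filter_upwards [this] with n hn
          simp [hi, hn]
      exact this.exists
    choose g hg using hex
    have := Measure.hausdorffMeasure_le_liminf_tsum (β := ℕ) (l := atTop)
      (ι := fun k => {i : ι // i ∈ S (g k) ∧ k ≤ lev i}) 1 R r hr (fun k i => E i.1)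
      (Eventually.of_forall fun k i => hE k i.1 i.2.2)
      (Eventually.of_forall fun k p hp => by
        have hpN : p ∉ Z \ ⋃ i ∈ S (g k), E i := fun hh => hp.2 (mem_iUnion.2 ⟨_, hh⟩)
        have hpZ : p ∈ Z := hp.1.1
        have hpS := hp.1.2
        simp only [Set.mem_sdiff, hpZ, true_and, not_not, mem_iUnion] at hpN hpS
        obtain ⟨i, hi, hpi⟩ := hpN
        refine mem_iUnion.2 ⟨⟨i, hi, ?_⟩, hpi⟩
        by_contra hlt
        exact hpS ⟨i, (hg k i (not_le.1 hlt)).1 hi, hpi⟩)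
    refine this.trans ?_
    refine liminf_le_of_le (by isBoundedDefault) ?_
    intro b hb
    obtain ⟨k, hk⟩ := hb.exists
    refine hk.trans ?_
    have hc2 : c / 2 ≠ 0 := by simp [hc0]
    have hc2' : c / 2 ≠ ⊤ := (ENNReal.div_lt_top hct (by simp)).ne
    rw [← ENNReal.mul_le_iff_le_inv hc2 hc2', ← ENNReal.tsum_mul_left]
    refine le_trans ?_ (hSv (g k))
    refine le_trans ?_ (ENNReal.tsum_comp_le_tsum_of_injective
      (f := fun i : {i : ι // i ∈ S (g k) ∧ k ≤ lev i} => (⟨i.1, i.2.1⟩ : S (g k)))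
      (fun a b hab => by simpa [Subtype.ext_iff] using hab) _)
    refine ENNReal.tsum_le_tsum fun i => ?_
    simp only [ENNReal.rpow_one]
    gcongr
    split_ifs
    · exact ENNReal.half_le_self.trans (hc _)
    · gcongr
      exact hc _
  have hRs : IsH1SigmaFinite R := sf_finite (hRm.trans_lt (ENNReal.mul_lt_top (by
    rw [ENNReal.inv_lt_top]; exact ENNReal.half_pos hc0) hv.lt_top))
  have := h S' (sf_mono (S' := N ∪ R) (fun p hp => by
    by_cases hpN : p ∈ N
    · exact Or.inl hpN
    · exact Or.inr ⟨hp, hpN⟩) (sf_union hNs hRs))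
  exact absurd hcost (not_le.2 this)

open Classical in
lemma weights {M : Type*} [MetricSpace M] [MeasurableSpace M] [BorelSpace M]
    {ι : Type*} [Countable ι] (lev : ι → ℕ) (hfin : ∀ n, {i | lev i < n}.Finite)
    (E : ι → Set M) (r : ℕ → ℝ≥0∞) (hr : Tendsto r atTop (𝓝 0))
    (hE : ∀ n i, n ≤ lev i → ediam (E i) ≤ r n) (Z : Set M)
    (v : ℝ≥0∞) (hv : v ≠ ⊤)
    (h : ∀ S : Set ι, IsH1SigmaFinite (Z \ ⋃ i ∈ S, E i) → v < ∑' i : S, ediam (E i)) :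
    ∃ w : ℕ → ι → ℝ≥0∞, (∀ k i, w (k + 1) i ≤ w k i) ∧ (∀ i, w 0 i = 1) ∧
      (∀ k, ∃ m, ∀ i, m ≤ lev i → w k i ≤ (2⁻¹ : ℝ≥0∞) ^ k) ∧
      ∀ k, ∀ S : Set ι, IsH1SigmaFinite (Z \ ⋃ i ∈ S, E i) →
        v < ∑' i : S, w k i * ediam (E i) := by
  set P : (ι → ℝ≥0∞) → Prop := fun w => (∃ c : ℝ≥0∞, c ≠ 0 ∧ c ≠ ⊤ ∧ ∀ i, c ≤ w i) ∧
    ∀ S : Set ι, IsH1SigmaFinite (Z \ ⋃ i ∈ S, E i) → v < ∑' i : S, w i * ediam (E i) with hP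
  set half : ℕ → (ι → ℝ≥0∞) → ι → ℝ≥0∞ := fun n w i => if lev i < n then w i else w i / 2
    with hhalf
  have hstep : ∀ w, ∃ n, P w → P (half n w) := by
    intro w
    by_cases hw : P w
    · obtain ⟨⟨c, hc0, hct, hc⟩, hg⟩ := hw
      obtain ⟨n, hn⟩ := step lev hfin E r hr hE Z w c hc0 hct hc v hv hg
      refine ⟨n, fun _ => ⟨⟨c / 2, by simp [hc0], (ENNReal.div_lt_top hct (by simp)).ne, ?_⟩, hn⟩⟩
      intro i
      simp only [hhalf]
      split_ifs
      · exact ENNReal.half_le_self.trans (hc _)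
      · gcongr
        exact hc _
    · exact ⟨0, fun h => absurd h hw⟩
  choose nn hnn using hstep
  set w : ℕ → ι → ℝ≥0∞ := fun k => Nat.rec (fun _ => 1) (fun _ w => half (nn w) w) k with hw
  have hw1 : ∀ k, w (k + 1) = half (nn (w k)) (w k) := fun k => rfl
  have hw0 : w 0 = fun _ => 1 := rfl
  have hPk : ∀ k, P (w k) := by
    intro k
    induction k with
    | zero => exact ⟨⟨1, one_ne_zero, ENNReal.one_ne_top, fun i => le_rfl⟩, by simpa [hw0] using h⟩
    | succ k ih => rw [hw1]; exact hnn _ ih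
  refine ⟨w, ?_, fun i => rfl, ?_, fun k => (hPk k).2⟩
  · intro k i
    rw [hw1]
    simp only [hhalf]
    split_ifs
    · exact le_rfl
    · exact ENNReal.half_le_self
  · intro k
    induction k with
    | zero => exact ⟨0, fun i _ => by simp [hw0]⟩
    | succ k ih =>
      obtain ⟨m, hm⟩ := ih
      refine ⟨max m (nn (w k)), fun i hi => ?_⟩
      rw [hw1]
      simp only [hhalf]
      rw [if_neg (not_lt.2 ((le_max_right _ _).trans hi)), pow_succ, ENNReal.div_eq_inv_mul,
        mul_comm]
      gcongr
      exact hm i ((le_max_left _ _).trans hi)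

lemma net {M : Type*} [MetricSpace M] [CompactSpace M] (K : ℝ) (hK : 1 < K) (r : ℝ) (hr : 0 < r) :
    ∃ Q : Set (Set M), Q.Finite ∧ ∀ A : Set M, ENNReal.ofReal r ≤ ediam A →
      ∃ I ∈ Q, A ⊆ I ∧ ediam I ≤ ENNReal.ofReal K * ediam A := by
  set η := (K - 1) * r / 4 with hη
  have hη0 : 0 < η := by have := sub_pos.2 hK; positivity
  obtain ⟨N, -, hNf, hN⟩ := finite_cover_balls_of_compact (isCompact_univ (X := M)) hη0
  refine ⟨(fun B : Set M => ⋃ a ∈ B, ball a η) '' {B | B ⊆ N}, hNf.finite_subsets.image _, ?_⟩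
  intro A hA
  refine ⟨_, ⟨{a ∈ N | (ball a η ∩ A).Nonempty}, fun a ha => ha.1, rfl⟩, ?_, ?_⟩
  · intro p hp
    obtain ⟨a, ha, hpa⟩ := mem_iUnion₂.1 (hN (mem_univ p))
    exact mem_iUnion₂.2 ⟨a, ⟨ha, p, hpa, hp⟩, hpa⟩
  · have h4 : ENNReal.ofReal K * ediam A = ediam A + ENNReal.ofReal (K - 1) * ediam A := by
      have : ENNReal.ofReal K = 1 + ENNReal.ofReal (K - 1) := by
        rw [← ENNReal.ofReal_one, ← ENNReal.ofReal_add zero_le_one (by linarith)]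
        congr 1; ring
      rw [this, add_mul, one_mul]
    have h5 : ENNReal.ofReal (4 * η) ≤ ENNReal.ofReal (K - 1) * ediam A := by
      have : 4 * η = (K - 1) * r := by rw [hη]; ring
      rw [this, ENNReal.ofReal_mul (by linarith)]
      gcongr
    rw [h4]
    refine ediam_le ?_
    intro p hp q hq
    obtain ⟨a, ⟨-, p', hp'a, hp'⟩, hpa⟩ := mem_iUnion₂.1 hp
    obtain ⟨b, ⟨-, q', hq'b, hq'⟩, hqb⟩ := mem_iUnion₂.1 hq
    refine le_trans ?_ (add_le_add (edist_le_ediam_of_mem hp' hq') h5)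
    rw [edist_dist, edist_dist, ← ENNReal.ofReal_add dist_nonneg (by positivity)]
    apply ENNReal.ofReal_le_ofReal
    rw [mem_ball] at *
    have e1 := dist_triangle p a p'
    have e2 := dist_triangle q b q'
    have e3 := dist_triangle4 p p' q' q
    rw [dist_comm a p'] at e1
    rw [dist_comm b q'] at e2
    rw [dist_comm q' q] at e3
    linarith

lemma family {M : Type*} [MetricSpace M] [CompactSpace M] (K : ℝ) (hK : 1 < K) :
    ∃ (Q : ℕ → Set (Set M)) (R : ℝ), 0 < R ∧ (∀ m, (Q m).Finite) ∧
      (∀ m, ∀ I ∈ Q m, ediam I ≤ ENNReal.ofReal (K * (R * (1 / 2) ^ m))) ∧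
      ∀ (A : Set M) (d : ℝ), 0 < d → ediam A = ENNReal.ofReal d → ∃ m, ∃ I ∈ Q m, A ⊆ I ∧
        ediam I ≤ ENNReal.ofReal (K * d) ∧ R * (1 / 2) ^ (m + 1) < d := by
  set R := Metric.diam (univ : Set M) + 1 with hR
  have hR0 : 0 < R := by have := Metric.diam_nonneg (s := (univ : Set M)); positivity
  have hp : ∀ m : ℕ, 0 < R * (1 / 2 : ℝ) ^ (m + 1) := fun m => by positivity
  choose Q hQf hQ using fun m : ℕ => net (M := M) K hK _ (hp m)
  refine ⟨fun m => {I ∈ Q m | ediam I ≤ ENNReal.ofReal (K * (R * (1 / 2) ^ m))}, R, hR0,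
    fun m => (hQf m).subset (sep_subset _ _), fun m I hI => hI.2, ?_⟩
  intro A d hd hA
  have hdR : d ≤ R := by
    have h1 : ediam A ≤ ediam (univ : Set M) := ediam_mono (subset_univ _)
    rw [hA] at h1
    have h2 := ENNReal.toReal_mono (isBounded_of_compactSpace (s := (univ : Set M))).ediam_ne_top h1
    rw [ENNReal.toReal_ofReal hd.le] at h2
    have : (ediam (univ : Set M)).toReal = Metric.diam (univ : Set M) := rfl
    linarith
  obtain ⟨m, hm1, hm2⟩ := exists_nat_pow_near_of_lt_one (x := d / R) (y := (1 / 2 : ℝ))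
    (by positivity) ((div_le_one hR0).2 hdR) (by norm_num) (by norm_num)
  rw [lt_div_iff₀ hR0, mul_comm] at hm1
  rw [div_le_iff₀ hR0, mul_comm] at hm2
  obtain ⟨I, hI, hAI, hI2⟩ := hQ m A (by rw [hA]; exact ENNReal.ofReal_le_ofReal hm1.le)
  rw [hA, ← ENNReal.ofReal_mul (by linarith)] at hI2
  refine ⟨m, I, ⟨hI, hI2.trans (ENNReal.ofReal_le_ofReal ?_)⟩, hAI, hI2, hm1⟩
  gcongr

lemma arc_triangle {T : Type*} [MetricSpace T]
    (arc : T → T → Set T)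
    (harc_self : ∀ x : T, arc x x = {x})
    (hexists : ∀ x y : T, x ≠ y → ∃ γ : ℝ → T, IsArcParam γ x y)
    (himage : ∀ (x y : T) (γ : ℝ → T), x ≠ y → IsArcParam γ x y →
      arc x y = γ '' Set.Icc 0 1) (x q p : T) : arc x p ⊆ arc x q ∪ arc q p := by
  by_cases hxq : x = q
  · subst hxq; exact subset_union_right
  by_cases hqp : q = p
  · subst hqp; exact subset_union_left
  obtain ⟨α, hα⟩ := hexists x q hxq
  obtain ⟨β, hβ⟩ := hexists q p hqp
  have hα' := himage _ _ _ hxq hα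
  have hβ' := himage _ _ _ hqp hβ
  obtain ⟨hαc, hαi, hα0, hα1⟩ := hα
  obtain ⟨hβc, hβi, hβ0, hβ1⟩ := hβ
  by_cases hxp : x = p
  · subst hxp
    rw [harc_self, hα']
    rintro _ rfl
    exact Or.inl ⟨0, by simp, hα0⟩
  have hBc : IsClosed (β '' Icc 0 1) := (isCompact_Icc.image_of_continuousOn hβc).isClosed
  have hC : IsCompact (Icc (0:ℝ) 1 ∩ α ⁻¹' (β '' Icc 0 1)) :=
    isCompact_Icc.of_isClosed_subset (hαc.preimage_isClosed_of_isClosed isClosed_Icc hBc)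
      inter_subset_left
  have hCne : (Icc (0:ℝ) 1 ∩ α ⁻¹' (β '' Icc 0 1)).Nonempty :=
    ⟨1, by simp, 0, by simp, by rw [hα1, hβ0]⟩
  obtain ⟨t0, ⟨ht0, s0, hs0, hst⟩, hmin⟩ := hC.exists_isLeast hCne
  have hbefore : ∀ t ∈ Icc (0:ℝ) 1, t < t0 → ∀ s ∈ Icc (0:ℝ) 1, α t ≠ β s := by
    intro t ht htt s hs hts
    exact absurd (hmin ⟨ht, s, hs, hts.symm⟩) (not_le.2 htt)
  set L := t0 + (1 - s0) with hL
  have hL0 : 0 < L := by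
    rcases lt_or_eq_of_le (show 0 ≤ L by have := ht0.1; have := hs0.2; linarith) with h | h
    · exact h
    · exfalso
      have h1 : t0 = 0 := by have := ht0.1; have := hs0.2; linarith
      have h2 : s0 = 1 := by have := ht0.1; have := hs0.2; linarith
      apply hxp
      rw [← hα0, ← hβ1, ← h1, ← h2, hst]
  set γ : ℝ → T := fun u => if L * u ≤ t0 then α (L * u) else β (s0 + (L * u - t0)) with hγ
  have hr1 : ∀ u ∈ Icc (0:ℝ) 1, L * u ≤ t0 → L * u ∈ Icc (0:ℝ) 1 := fun u hu h =>
    ⟨mul_nonneg hL0.le hu.1, h.trans ht0.2⟩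
  have hr2 : ∀ u ∈ Icc (0:ℝ) 1, t0 ≤ L * u → s0 + (L * u - t0) ∈ Icc (0:ℝ) 1 := fun u hu h =>
    ⟨by have := hs0.1; linarith, by nlinarith [hu.2]⟩
  have hγp : IsArcParam γ x p := by
    refine ⟨?_, ?_, ?_, ?_⟩
    · have hc1 : ContinuousOn (fun u : ℝ => L * u) (Icc 0 1) := by fun_prop
      refine ContinuousOn.if ?_ ?_ ?_
      · rintro u ⟨hu, hfr⟩
        have hfr' := frontier_le_subset_eq (f := fun u : ℝ => L * u) (g := fun _ => t0)
          (by fun_prop) (by fun_prop) hfr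
        have : L * u = t0 := hfr'
        rw [this, sub_self, add_zero, hst]
      · have hcl : closure {u : ℝ | L * u ≤ t0} = {u : ℝ | L * u ≤ t0} :=
          (isClosed_le (by fun_prop) (by fun_prop)).closure_eq
        rw [hcl]
        exact hαc.comp (by fun_prop) (fun u hu => hr1 u hu.1 hu.2)
      · have hcl : closure {u : ℝ | ¬ L * u ≤ t0} ⊆ {u : ℝ | t0 ≤ L * u} :=
          closure_minimal (fun u hu => (not_le.1 hu).le) (isClosed_le (by fun_prop) (by fun_prop))
        exact hβc.comp (by fun_prop) (fun u hu => hr2 u hu.1 (hcl hu.2))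
    · intro u hu u' hu' huu
      have key : L * u = L * u' := by
        simp only [hγ] at huu
        split_ifs at huu with h1 h2 h2
        · exact hαi (hr1 u hu h1) (hr1 u' hu' h2) huu
        · exfalso
          have h2' := not_le.1 h2
          rcases lt_or_eq_of_le h1 with h3 | h3
          · exact hbefore _ (hr1 u hu h1) h3 _ (hr2 u' hu' h2'.le) huu
          · rw [h3, ← hst] at huu
            have := hβi hs0 (hr2 u' hu' h2'.le) huu
            linarith
        · exfalso
          have h1' := not_le.1 h1
          rcases lt_or_eq_of_le h2 with h3 | h3
          · exact hbefore _ (hr1 u' hu' h2) h3 _ (hr2 u hu h1'.le) huu.symm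
          · rw [h3, ← hst] at huu
            have := hβi hs0 (hr2 u hu h1'.le) huu.symm
            linarith
        · have := hβi (hr2 u hu (not_le.1 h1).le) (hr2 u' hu' (not_le.1 h2).le) huu
          linarith
      exact mul_left_cancel₀ hL0.ne' key
    · simp only [hγ, mul_zero]
      rw [if_pos ht0.1, hα0]
    · simp only [hγ, mul_one]
      split_ifs with h
      · have h2 : s0 = 1 := by have := hs0.2; linarith
        have h3 : L = t0 := by rw [hL, h2]; ring
        rw [h3, ← hst, h2, hβ1]
      · rw [show s0 + (L - t0) = 1 by rw [hL]; ring, hβ1]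
  rw [himage x p γ hxp hγp, hα', hβ']
  rintro _ ⟨u, hu, rfl⟩
  simp only [hγ]
  split_ifs with h
  · exact Or.inl ⟨_, hr1 u hu h, rfl⟩
  · exact Or.inr ⟨_, hr2 u hu (not_le.1 h).le, rfl⟩

lemma content_le {M : Type*} [MetricSpace M] {ι : Type*} [Countable ι] (E : ι → Set M)
    (S : Set ι) : hausdorffContent (⋃ i ∈ S, E i) ≤ ∑' i : S, ediam (E i) := by
  haveI : Encodable S := Encodable.ofCountable S
  have h := tsum_iUnion_decode₂ (fun s : Set M => ediam s) (by simp) (fun i : S => E i)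
  rw [← h]
  refine iInf₂_le (fun n => ⋃ b ∈ Encodable.decode₂ S n, E b) ?_
  rw [Encodable.iUnion_decode₂, biUnion_eq_iUnion]

lemma arc_ediam {T : Type*} [MetricSpace T]
    (arc : T → T → Set T)
    (hexists : ∀ x y : T, x ≠ y → ∃ γ : ℝ → T, IsArcParam γ x y)
    (himage : ∀ (x y : T) (γ : ℝ → T), x ≠ y → IsArcParam γ x y →
      arc x y = γ '' Set.Icc 0 1)
    (hbt : ∀ (x y : T) (γ : ℝ → T), x ≠ y → IsArcParam γ x y →
      ∀ s t u : ℝ, s ∈ Set.Icc (0:ℝ) 1 → t ∈ Set.Icc (0:ℝ) 1 → u ∈ Set.Icc (0:ℝ) 1 →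
        s ≤ t → t ≤ u → max (dist (γ s) (γ t)) (dist (γ t) (γ u)) ≤ dist (γ s) (γ u))
    (x y : T) (hxy : x ≠ y) : ediam (arc x y) = ENNReal.ofReal (dist x y) := by
  obtain ⟨γ, hγ⟩ := hexists x y hxy
  have hb := hbt x y γ hxy hγ
  rw [himage x y γ hxy hγ, ← edist_dist]
  obtain ⟨-, -, h0, h1⟩ := hγ
  have z0 : (0:ℝ) ∈ Icc (0:ℝ) 1 := by simp
  have z1 : (1:ℝ) ∈ Icc (0:ℝ) 1 := by simp
  have key : ∀ s ∈ Icc (0:ℝ) 1, ∀ t ∈ Icc (0:ℝ) 1, s ≤ t → dist (γ s) (γ t) ≤ dist x y := by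
    intro s hs t ht hst
    rw [← h0, ← h1]
    exact ((le_max_left _ _).trans (hb s t 1 hs ht z1 hst ht.2)).trans
      ((le_max_right _ _).trans (hb 0 s 1 z0 hs z1 hs.1 hs.2))
  refine le_antisymm (ediam_le ?_) (edist_le_ediam_of_mem ⟨0, z0, h0⟩ ⟨1, z1, h1⟩)
  rintro _ ⟨s, hs, rfl⟩ _ ⟨t, ht, rfl⟩
  rw [edist_dist, edist_dist]
  apply ENNReal.ofReal_le_ofReal
  rcases le_total s t with h | h
  · exact key s hs t ht h
  · rw [dist_comm]; exact key t ht s hs h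

lemma construct
    {T : Type*} [MetricSpace T] [CompactSpace T] [MeasurableSpace T] [BorelSpace T]
    (arc : T → T → Set T)
    (harc_self : ∀ x : T, arc x x = {x})
    (htri : ∀ x q p : T, arc x p ⊆ arc x q ∪ arc q p)
    (hdiam : ∀ x y : T, x ≠ y → ediam (arc x y) = ENNReal.ofReal (dist x y))
    (x y : T) (v : ℝ≥0∞) (hv : v ≠ ⊤) (K : ℝ) (hK : 1 < K)
    (hvC : v < ⨅ (A : Set T) (_ : IsH1SigmaFinite (arc x y \ A)), hausdorffContent A) :
    ∃ f : T → ℝ, (LipschitzWith 1 f ∧ LocallyFlat f) ∧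
      v ≤ ENNReal.ofReal K * ENNReal.ofReal |f y - f x| := by
  have hK0 : 0 < K := by linarith
  obtain ⟨Q, R, hR0, hQf, hQd, hQ⟩ := family (M := T) K hK
  haveI : ∀ m, Finite (Q m) := fun m => (hQf m).to_subtype
  let ι := Σ m, Q m
  let lev : ι → ℕ := fun i => i.1
  let E : ι → Set T := fun i => i.2.1
  have hfin : ∀ n, {i | lev i < n}.Finite := by
    intro n
    refine (Set.finite_range (fun j : Σ m : Fin n, Q m => (⟨j.1, j.2⟩ : ι))).subset ?_
    rintro ⟨m, I⟩ hm
    exact ⟨⟨⟨m, hm⟩, I⟩, rfl⟩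
  have hhalf : Tendsto (fun m : ℕ => K * (R * (1 / 2 : ℝ) ^ m)) atTop (𝓝 0) := by
    have := ((tendsto_pow_atTop_nhds_zero_of_lt_one (r := (1 / 2 : ℝ)) (by norm_num)
      (by norm_num)).const_mul R).const_mul K
    simpa using this
  have hr : Tendsto (fun m : ℕ => ENNReal.ofReal (K * (R * (1 / 2 : ℝ) ^ m))) atTop (𝓝 0) := by
    have := (ENNReal.continuous_ofReal.tendsto 0).comp hhalf
    rwa [ENNReal.ofReal_zero] at this
  have hE : ∀ n i, n ≤ lev i → ediam (E i) ≤ ENNReal.ofReal (K * (R * (1 / 2 : ℝ) ^ n)) := by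
    intro n i hn
    refine (hQd i.1 i.2.1 i.2.2).trans (ENNReal.ofReal_le_ofReal ?_)
    have : (1 / 2 : ℝ) ^ i.1 ≤ (1 / 2) ^ n := pow_le_pow_of_le_one (by norm_num) (by norm_num) hn
    gcongr
  obtain ⟨w, hwa, hw0, hws, hwg⟩ := weights lev hfin E _ hr hE (arc x y) v hv (by
    intro S hS
    exact (hvC.trans_le (iInf₂_le (⋃ i ∈ S, E i) hS)).trans_le (content_le E S))
  have hwanti : ∀ i, Antitone (fun k => w k i) := fun i => antitone_nat_of_succ_le (fun k => hwa k i)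
  let G : ℕ → T → ℝ≥0∞ := fun k p =>
    ⨅ (S : Set ι) (_ : arc x p \ {x} ⊆ ⋃ i ∈ S, E i), ∑' i : S, w k i * ediam (E i)
  let g : T → ℝ≥0∞ := fun p => ⨅ k, G k p
  have hGanti : ∀ p, Antitone (fun k => G k p) := by
    intro p k l hkl
    refine iInf₂_mono fun S _ => ENNReal.tsum_le_tsum fun i => ?_
    gcongr
    exact hwanti i hkl
  have hG1 : ∀ k p q i, arc q p ⊆ E i → G k p ≤ G k q + w k i * ediam (E i) := by
    intro k p q i hi
    simp only [G, ENNReal.iInf_add]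
    refine le_iInf₂ fun S hS => ?_
    refine (iInf₂_le (S ∪ {i}) ?_).trans ((ENNReal.tsum_union_le
      (fun i => w k i * ediam (E i)) S {i}).trans ?_)
    · intro z hz
      rcases htri x q p hz.1 with h | h
      · obtain ⟨j, hj, hzj⟩ := mem_iUnion₂.1 (hS ⟨h, hz.2⟩)
        exact mem_iUnion₂.2 ⟨j, Or.inl hj, hzj⟩
      · exact mem_iUnion₂.2 ⟨i, Or.inr rfl, hi h⟩
    · rw [tsum_singleton i (fun i => w k i * ediam (E i))]
  have hg1 : ∀ k p q i, arc q p ⊆ E i → g p ≤ g q + w k i * ediam (E i) := by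
    intro k p q i hi
    simp only [g, ENNReal.iInf_add]
    refine le_iInf fun l => ?_
    refine (iInf_le _ (max l k)).trans ((hG1 _ p q i hi).trans ?_)
    gcongr
    · exact hGanti q (le_max_left _ _)
    · exact hwanti i (le_max_right _ _)
  have hgx : g x = 0 := by
    refine le_antisymm ((iInf_le _ 0).trans ((iInf₂_le ∅ (by simp [harc_self])).trans ?_)) bot_le
    simp
  have hgy : v ≤ g y := by
    refine le_iInf fun k => le_iInf₂ fun S hS => (hwg k S ?_).le
    refine sf_finite (lt_of_le_of_lt (measure_mono (t := {x}) ?_) ?_)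
    · intro z hz
      by_contra hzx
      exact hz.2 (hS ⟨hz.1, hzx⟩)
    · haveI := Measure.noAtoms_hausdorff T (d := 1) one_pos
      rw [measure_singleton]
      simp
  have hgfin : ∀ p, g p ≠ ⊤ := by
    intro p
    by_cases hp : x = p
    · rw [← hp, hgx]; simp
    · obtain ⟨m, I, hI, hsub, hId, -⟩ := hQ (arc x p) _ (dist_pos.2 hp) (hdiam x p hp)
      refine ((hg1 0 p x ⟨m, I, hI⟩ hsub).trans_lt ?_).ne
      rw [hgx, zero_add, hw0, one_mul]
      exact hId.trans_lt ENNReal.ofReal_lt_top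
  have hone : ∀ (θ : ℝ), 0 ≤ θ → ∀ k p q, (∀ i, R * (1 / 2) ^ (lev i + 1) < dist p q →
      w k i ≤ ENNReal.ofReal θ) → (g p).toReal ≤ (g q).toReal + θ * (K * dist p q) := by
    intro θ hθ k p q h
    by_cases hpq : q = p
    · subst hpq; simp
    obtain ⟨m, I, hI, hsub, hId, hm⟩ := hQ (arc q p) _ (dist_pos.2 hpq) (hdiam q p hpq)
    rw [dist_comm] at hId hm
    have h1 : g p ≤ g q + ENNReal.ofReal (θ * (K * dist p q)) := by
      refine (hg1 k p q ⟨m, I, hI⟩ hsub).trans ?_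
      rw [ENNReal.ofReal_mul hθ]
      gcongr
      exact h _ hm
    have h2 := ENNReal.toReal_mono (ENNReal.add_ne_top.2 ⟨hgfin q, ENNReal.ofReal_ne_top⟩) h1
    rwa [ENNReal.toReal_add (hgfin q) ENNReal.ofReal_ne_top,
      ENNReal.toReal_ofReal (by positivity)] at h2
  let f : T → ℝ := fun p => (g p).toReal / K
  have htwo : ∀ (θ : ℝ), 0 ≤ θ → ∀ k p q, (∀ i, R * (1 / 2) ^ (lev i + 1) < dist p q →
      w k i ≤ ENNReal.ofReal θ) → |f p - f q| ≤ θ * dist p q := by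
    intro θ hθ k p q h
    have h1 := hone θ hθ k p q h
    have h2 := hone θ hθ k q p (by rwa [dist_comm q p])
    rw [dist_comm q p] at h2
    have : f p - f q = ((g p).toReal - (g q).toReal) / K := by simp only [f]; ring
    rw [this, abs_div, abs_of_pos hK0, div_le_iff₀ hK0, abs_le]
    constructor <;> nlinarith
  refine ⟨f, ⟨?_, ?_⟩, ?_⟩
  · refine LipschitzWith.of_dist_le_mul fun p q => ?_
    exact htwo 1 zero_le_one 0 p q (fun i _ => by simp [hw0])
  · intro p ε hε
    obtain ⟨k, hk⟩ := exists_pow_lt_of_lt_one hε (show (1 / 2 : ℝ) < 1 by norm_num)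
    obtain ⟨m, hm⟩ := hws k
    refine ⟨R * (1 / 2) ^ (m + 1) / 2, by positivity, fun a b ha hb => ?_⟩
    refine htwo ε hε.le k a b fun i hi => ?_
    have hab : dist a b < R * (1 / 2) ^ (m + 1) := by
      have := dist_triangle_right a b p
      linarith
    have h3 : (1 / 2 : ℝ) ^ (lev i + 1) < (1 / 2) ^ (m + 1) :=
      lt_of_mul_lt_mul_left (hi.trans hab) hR0.le
    have h4 : m + 1 < lev i + 1 :=
      (pow_lt_pow_iff_right_of_lt_one₀ (by norm_num) (by norm_num)).1 h3
    refine (hm i (by omega)).trans ?_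
    have : (2⁻¹ : ℝ≥0∞) ^ k = ENNReal.ofReal ((1 / 2) ^ k) := by
      rw [ENNReal.ofReal_pow (by norm_num), one_div, ENNReal.ofReal_inv_of_pos (by norm_num)]
      simp
    rw [this]
    exact ENNReal.ofReal_le_ofReal hk.le
  · have h0 : f x = 0 := by simp [f, hgx]
    rw [h0, sub_zero, ← ENNReal.ofReal_mul hK0.le]
    have : K * |f y| = (g y).toReal := by
      rw [abs_of_nonneg (by simp only [f]; positivity)]
      simp only [f]; field_simp
    rw [this, ENNReal.ofReal_toReal (hgfin y)]
    exact hgy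

end helpers

/-- **Theorem F (for 1-bounded turning trees).** Let `T` be a compact metric space in which
every pair of distinct points `x, y` is joined by a unique arc `arc x y` (with
`arc x x = {x}`), and every such arc satisfies the 1-bounded turning condition. Then for
all `x, y ∈ T`, the supremum of `|f y - f x|` over 1-Lipschitz locally flat `f : T → ℝ`
equals the infimum of `H¹_∞(A)` over all `A ⊆ T` such that `arc x y ∖ A` is
`H¹`-σ-finite. -/
theorem sup_locallyFlat_eq_inf_content_bounded_turning_tree
    {T : Type*} [MetricSpace T] [CompactSpace T] [MeasurableSpace T] [BorelSpace T]
    (arc : T → T → Set T)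
    (harc_self : ∀ x : T, arc x x = {x})
    (hexists : ∀ x y : T, x ≠ y → ∃ γ : ℝ → T, IsArcParam γ x y)
    (himage : ∀ (x y : T) (γ : ℝ → T), x ≠ y → IsArcParam γ x y →
      arc x y = γ '' Set.Icc 0 1)
    (hbt : ∀ (x y : T) (γ : ℝ → T), x ≠ y → IsArcParam γ x y →
      ∀ s t u : ℝ, s ∈ Set.Icc (0:ℝ) 1 → t ∈ Set.Icc (0:ℝ) 1 → u ∈ Set.Icc (0:ℝ) 1 →
        s ≤ t → t ≤ u → max (dist (γ s) (γ t)) (dist (γ t) (γ u)) ≤ dist (γ s) (γ u))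
    (x y : T) :
    (⨆ (f : T → ℝ) (_ : LipschitzWith 1 f ∧ LocallyFlat f),
        ENNReal.ofReal |f y - f x|) =
      ⨅ (A : Set T) (_ : IsH1SigmaFinite (arc x y \ A)), hausdorffContent A := by
  have htri := arc_triangle arc harc_self hexists himage
  have hdiam := arc_ediam arc hexists himage hbt
  apply le_antisymm
  · refine iSup₂_le fun f hf => le_iInf₂ fun A hA => ?_
    refine le_trans ?_ (flat_le hf.1 hf.2 (arc x y) A hA)
    by_cases hxy : x = y
    · subst hxy; simp
    obtain ⟨γ, hγ⟩ := hexists x y hxy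
    have him := himage x y γ hxy hγ
    obtain ⟨hc, -, h0, h1⟩ := hγ
    have hconn : IsPreconnected (f '' arc x y) := by
      rw [him]
      exact (isPreconnected_Icc.image γ hc).image f hf.1.continuous.continuousOn
    have hx : f x ∈ f '' arc x y := ⟨x, by rw [him]; exact ⟨0, by simp, h0⟩, rfl⟩
    have hy : f y ∈ f '' arc x y := ⟨y, by rw [him]; exact ⟨1, by simp, h1⟩, rfl⟩
    have hsub : uIcc (f x) (f y) ⊆ f '' arc x y := hconn.ordConnected.uIcc_subset hx hy
    have := measure_mono (μ := (volume : Measure ℝ)) hsub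
    rwa [Real.volume_interval] at this
  · refine le_of_forall_lt fun v hv => ?_
    obtain ⟨v', hvv', hv'⟩ := exists_between hv
    have hvt : v ≠ ⊤ := hvv'.ne_top
    have hvt' : v' ≠ ⊤ := hv'.ne_top
    set s := ⨆ (f : T → ℝ) (_ : LipschitzWith 1 f ∧ LocallyFlat f), ENNReal.ofReal |f y - f x|
      with hs
    refine lt_of_lt_of_le hvv' ?_
    by_cases hst : s = ⊤
    · rw [hst]; exact le_top
    have key : ∀ K : ℝ, 1 < K → v' ≤ ENNReal.ofReal K * s := by
      intro K hK
      obtain ⟨f, hf, hfv⟩ := construct arc harc_self htri hdiam x y v' hvt' K hK hv'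
      refine hfv.trans ?_
      gcongr
      exact le_iSup₂ (f := fun (f : T → ℝ) (_ : LipschitzWith 1 f ∧ LocallyFlat f) =>
        ENNReal.ofReal |f y - f x|) f hf
    have ht : Filter.Tendsto (fun K : ℝ => ENNReal.ofReal K * s) (nhdsWithin 1 (Ioi 1))
        (nhds (ENNReal.ofReal 1 * s)) :=
      (ENNReal.Tendsto.mul_const (ENNReal.continuous_ofReal.tendsto 1) (Or.inr hst)).mono_left
        nhdsWithin_le_nhds
    have h2 := ge_of_tendsto ht (eventually_nhdsWithin_of_forall fun K hK => key K hK)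
    simpa using h2
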